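/- If (α,β) ∈ P × P̄ is two sided extremal, then Σ_{(α,β)} = Σ_{(ι(α), ι(β))}. -/

import Mathlib

open Filter MeasureTheory

namespace DoublingHole

/-- One-sided binary sequences (indexed from 0, corresponding to x₁x₂x₃⋯). -/
abbrev Seq : Type := ℕ → Bool

/-- The one-sided shift map σ. -/
def shift (x : Seq) : Seq := fun n => x (n + 1)

/-- Strict lexicographic order ≺ on sequences. -/
def lexLt (x y : Seq) : Prop := ∃ k : ℕ, (∀ i, i < k → x i = y i) ∧ x k < y k

/-- Reflexive lexicographic order ≼ on sequences. -/
def lexLe (x y : Seq) : Prop := lexLt x y ∨ x = y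

/-- The lexicographic subshift Σ_{(α,β)} = {x : β ≼ σⁿx ≼ α for all n ≥ 0}. -/
def lexSubshift (α β : Seq) : Set Seq :=
  {x | ∀ n : ℕ, lexLe β (shift^[n] x) ∧ lexLe (shift^[n] x) α}

/-- The projection π : Σ₂ → [0,1], π(x) = Σ xᵢ 2^{-i}. -/
noncomputable def piMap (x : Seq) : ℝ := ∑' i : ℕ, if x i then (1 : ℝ) / 2 ^ (i + 1) else 0

/-- The mirror image x̄ of a sequence. -/
def mirror (x : Seq) : Seq := fun n => !(x n)

/-- The set P of Parry sequences: α₁ = 1 and σⁿα ≼ α for all n ≥ 1. -/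
def ParryP : Set Seq := {α | α 0 = true ∧ ∀ n, 1 ≤ n → lexLe (shift^[n] α) α}

/-- The set P̄ of mirror images of Parry sequences. -/
def barP : Set Seq := {β | mirror β ∈ ParryP}

/-- Periodic sequences. -/
def PerSet : Set Seq := {x | ∃ k, 1 ≤ k ∧ shift^[k] x = x}

/-- Membership in the lexicographic world LW. -/
def inLW (α β : Seq) : Prop :=
  α ∈ ParryP ∧ β ∈ barP ∧ ∀ n, 1 ≤ n → lexLe β (shift^[n] α) ∧ lexLe (shift^[n] β) α

/-- The doubling map x ↦ 2x (mod 1) on S¹ identified with [0,1). -/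
noncomputable def dbl (x : ℝ) : ℝ := Int.fract (2 * x)

/-- The exceptional set X_{(a,b)} of points whose orbit avoids the hole (a,b). -/
def Xset (a b : ℝ) : Set ℝ :=
  {x | x ∈ Set.Ico (0 : ℝ) 1 ∧ ∀ n : ℕ, dbl^[n] x ∉ Set.Ioo a b}

/-- The attractor Λ_{(a,b)} = [2b-1, 2a] ∩ X_{(a,b)}. -/
def Lam (a b : ℝ) : Set ℝ := Set.Icc (2 * b - 1) (2 * a) ∩ Xset a b

/-- χ(a) = sup{b : X_{(a,b)} is uncountable}. -/
noncomputable def chiFn (a : ℝ) : ℝ :=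
  sSup {b | b ∈ Set.Ico (0 : ℝ) 1 ∧ ¬ (Xset a b).Countable}

/-- The parameter region D₁. -/
def D1 : Set (ℝ × ℝ) :=
  {p | p.1 ∈ Set.Ioo (1/4 : ℝ) (1/2) ∧ p.2 ∈ Set.Ioo (1/2 : ℝ) (3/4) ∧ p.2 ≤ chiFn p.1}

/-- The set S of parameters whose endpoints both fall into the hole. -/
def Sset : Set (ℝ × ℝ) :=
  {p | p ∈ D1 ∧ (∃ n, 1 ≤ n ∧ dbl^[n] p.1 ∈ Set.Ioo p.1 p.2) ∧
        ∃ m, 1 ≤ m ∧ dbl^[m] p.2 ∈ Set.Ioo p.1 p.2}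

/-- The finite word w occurs in (is a factor of) the sequence x. -/
def occursIn (w : List Bool) (x : Seq) : Prop :=
  ∃ i : ℕ, w = List.ofFn fun j : Fin w.length => x (i + (j : ℕ))

/-- The language of a subshift: all finite factors of its elements. -/
def Lang (A : Set Seq) : Set (List Bool) := {w | ∃ x ∈ A, occursIn w x}

/-- A set of sequences is a subshift of finite type if it is defined by
finitely many forbidden words. -/
def IsSFT (A : Set Seq) : Prop :=
  ∃ F : Finset (List Bool), A = {x | ∀ w ∈ F, ¬ occursIn w x}

/-- B_n(A): the admissible words of length n. -/
def wordsOfLen (A : Set Seq) (n : ℕ) : Set (List Bool) :=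
  {w | w.length = n ∧ w ∈ Lang A}

/-- Topological transitivity of a subshift, phrased via its language. -/
def TransitiveShift (A : Set Seq) : Prop :=
  ∀ u ∈ Lang A, ∀ v ∈ Lang A, ∃ t ∈ Lang A, u ++ t ++ v ∈ Lang A

/-- Cyclic rotation of a finite word. -/
def rot (w : List Bool) (k : ℕ) : List Bool := w.drop k ++ w.take k

/-- Lexicographic (dictionary) order on finite words. -/
def listLe (u v : List Bool) : Prop := List.Lex (· < ·) u v ∨ u = v

/-- w = 0-max_w : w starts with 0 and is the lexicographically largest
cyclic permutation of itself starting with 0. -/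
def isZeroMax (w : List Bool) : Prop :=
  w.headD true = false ∧
    ∀ k, k < w.length → (rot w k).headD true = false → listLe (rot w k) w

/-- w = 1-min_w : w starts with 1 and is the lexicographically smallest
cyclic permutation of itself starting with 1. -/
def isOneMin (w : List Bool) : Prop :=
  w.headD false = true ∧
    ∀ k, k < w.length → (rot w k).headD false = true → listLe w (rot w k)

/-- v is the 0-max cyclic permutation of w. -/
def isZeroMaxOf (v w : List Bool) : Prop :=
  (∃ k, k < w.length ∧ v = rot w k) ∧ v.headD true = false ∧
    ∀ k, k < w.length → (rot w k).headD true = false → listLe (rot w k) v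

/-- u is the 1-min cyclic permutation of w. -/
def isOneMinOf (u w : List Bool) : Prop :=
  (∃ k, k < w.length ∧ u = rot w k) ∧ u.headD false = true ∧
    ∀ k, k < w.length → (rot w k).headD false = true → listLe u (rot w k)

/-- The periodic sequence w^∞. -/
def periodicSeq (w : List Bool) : Seq := fun i => w.getD (i % w.length) false

/-- The sequence w followed by x. -/
def wordThen (w : List Bool) (x : Seq) : Seq :=
  fun i => if i < w.length then w.getD i false else x (i - w.length)

/-- Prepend one symbol to a sequence (e.g. 0α, 1β). -/
def consSeq (a : Bool) (x : Seq) : Seq := fun i => if i = 0 then a else x (i - 1)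

/-- A word is balanced if any two factors of equal length have numbers of 1's
differing by at most one. -/
def balanced (w : List Bool) : Prop :=
  ∀ u v : List Bool, u <:+: w → v <:+: w → u.length = v.length →
    ((u.count true : ℤ) - (v.count true : ℤ)).natAbs ≤ 1

/-- A word is cyclically balanced if its square is balanced. -/
def cycBalanced (w : List Bool) : Prop := balanced (w ++ w)

/-- Infinite concatenation of a sequence of (nonempty) finite words. -/
noncomputable def concatSeq (b : ℕ → List Bool) : Seq := fun i =>
  (b (sInf {n : ℕ | i < ∑ k ∈ Finset.range (n + 1), (b k).length})).getD
    (i - ∑ k ∈ Finset.range (sInf {n : ℕ | i < ∑ k ∈ Finset.range (n + 1), (b k).length}), (b k).length)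
    false

/-- (α,β) is renormalisable by the finite words ω and ν:
ω = 0-max_ω, ν = 1-min_ν, (0-max_ν)^∞ ≺ ω^∞, ν^∞ ≺ (1-min_ω)^∞, ℓ(ων) ≥ 3, and
0α = ω ν^{n₁^ν} ω^{n₁^ω} ν^{n₂^ν} ⋯ and 1β = ν ω^{m₁^ω} ν^{m₁^ν} ⋯ with all
exponents in ℕ ∪ {∞}; equivalently 0α (resp. 1β) is an infinite concatenation of
copies of ω and ν whose first two blocks are ω, ν (resp. ν, ω). -/
def RenormalisableBy (α β : Seq) (ω ν : List Bool) : Prop :=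
  isZeroMax ω ∧ isOneMin ν ∧
  (∀ v, isZeroMaxOf v ν → lexLt (periodicSeq v) (periodicSeq ω)) ∧
  (∀ u, isOneMinOf u ω → lexLt (periodicSeq ν) (periodicSeq u)) ∧
  3 ≤ ω.length + ν.length ∧
  (∃ b : ℕ → List Bool, b 0 = ω ∧ b 1 = ν ∧ (∀ k, b k = ω ∨ b k = ν) ∧
    consSeq false α = concatSeq b) ∧
  (∃ c : ℕ → List Bool, c 0 = ν ∧ c 1 = ω ∧ (∀ k, c k = ω ∨ c k = ν) ∧
    consSeq true β = concatSeq c)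

/-- (α,β) is renormalisable by an infinite sequence: either 0α = ω and 1β = νω
with ω infinite and ν = 1-min_ν finite, or 0α = ων and 1β = ν with ν infinite
and ω = 0-max_ω finite. -/
def RenormInfBy (α β : Seq) : Prop :=
  (∃ ν : List Bool, isOneMin ν ∧ consSeq true β = wordThen ν (consSeq false α)) ∨
  (∃ ω : List Bool, isZeroMax ω ∧ consSeq false α = wordThen ω (consSeq true β))

/-- n_α = min{n ≥ 1 : σⁿα ≻ α}. -/
noncomputable def nAlpha (α : Seq) : ℕ := sInf {n | 1 ≤ n ∧ lexLt α (shift^[n] α)}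

/-- The periodic sequence (α₁ ⋯ α_{n-1} 0)^∞. -/
def cutZero (α : Seq) (n : ℕ) : Seq :=
  fun i => if i % n = n - 1 then false else α (i % n)

/-- The periodic sequence (β₁ ⋯ β_{n-1} 1)^∞. -/
def cutOne (β : Seq) (n : ℕ) : Seq :=
  fun i => if i % n = n - 1 then true else β (i % n)

open Classical in
/-- The map ς : Σ₂¹ → Σ₂¹. -/
noncomputable def varsigma (α : Seq) : Seq :=
  if α ∈ ParryP then α else cutZero α (nAlpha α)

/-- The map ς' : Σ₂⁰ → Σ₂⁰, ς'(β) = mirror of ς(β̄). -/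
noncomputable def varsigma' (β : Seq) : Seq := mirror (varsigma (mirror β))

/-- M_α(β) = min{m ≥ 1 : σ^m β ≻ α}. -/
noncomputable def Msub (α β : Seq) : ℕ := sInf {m | 1 ≤ m ∧ lexLt α (shift^[m] β)}

/-- N_β(α) = min{n ≥ 1 : σⁿ α ≺ β}. -/
noncomputable def Nsub (α β : Seq) : ℕ := sInf {n | 1 ≤ n ∧ lexLt (shift^[n] α) β}

/-- ι(α) = (α₁ ⋯ α_{N_β(α)-1} 0)^∞. -/
noncomputable def iotaA (α β : Seq) : Seq := cutZero α (Nsub α β)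

/-- ι(β) = (β₁ ⋯ β_{M_α(β)-1} 1)^∞. -/
noncomputable def iotaB (α β : Seq) : Seq := cutOne β (Msub α β)

/-- ξ_α(β) = (β₁ ⋯ β_{M-1} 1)^∞ with M = M_α(β). -/
noncomputable def xiA (α β : Seq) : Seq := cutOne β (Msub α β)

/-- ξ'_β(α) = (α₁ ⋯ α_{N-1} 0)^∞ with N = N_β(α). -/
noncomputable def xiB (α β : Seq) : Seq := cutZero α (Nsub α β)

/-- A two sided extremal pair. -/
def twoSidedExtremal (α β : Seq) : Prop :=
  (∃ n, 1 ≤ n ∧ lexLt α (shift^[n] β)) ∧ (∃ m, 1 ≤ m ∧ lexLt (shift^[m] α) β)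

/-- A right extremal pair. -/
def rightExtremal (α β : Seq) : Prop :=
  (∀ m, 1 ≤ m → lexLt β (shift^[m] α)) ∧ (∃ n, 1 ≤ n ∧ lexLt α (shift^[n] β))

/-- A left extremal pair. -/
def leftExtremal (α β : Seq) : Prop :=
  (∀ n, 1 ≤ n → lexLt (shift^[n] β) α) ∧ (∃ m, 1 ≤ m ∧ lexLt (shift^[m] α) β)

/-- Dyadic rationals. -/
def IsDyadic (t : ℝ) : Prop := ∃ (z : ℤ) (n : ℕ), t = (z : ℝ) / 2 ^ n

/-- α₁ ⋯ α_n 1^∞. -/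
def onesAfter (α : Seq) (n : ℕ) : Seq := fun i => if i < n then α i else true

end DoublingHole

namespace DoublingHole

theorem lexLt_iff_toLex (x y : Seq) : lexLt x y ↔ toLex x < toLex y := Iff.rfl

theorem lexLe_iff_toLex (x y : Seq) : lexLe x y ↔ toLex x ≤ toLex y :=
  (le_iff_lt_or_eq (a := toLex x) (b := toLex y)).symm

theorem not_lexLt_iff (x y : Seq) : ¬ lexLt x y ↔ lexLe y x := by
  rw [lexLe_iff_toLex]
  exact not_lt (a := toLex x) (b := toLex y)

theorem shift_iterate_apply (n : ℕ) (x : Seq) (i : ℕ) : (shift^[n] x) i = x (i + n) := by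
  induction n generalizing x with
  | zero => rfl
  | succ n ih => rw [Function.iterate_succ_apply, ih, shift, Nat.add_assoc]

theorem shift_iterate_mirror (n : ℕ) (x : Seq) :
    shift^[n] (mirror x) = mirror (shift^[n] x) := by
  funext i
  simp only [shift_iterate_apply, mirror]

theorem mirror_mirror (x : Seq) : mirror (mirror x) = x := by
  funext i
  simp [mirror]

theorem mirror_injective : Function.Injective mirror :=
  Function.LeftInverse.injective mirror_mirror

theorem lexLt_mirror_iff (x y : Seq) : lexLt (mirror x) (mirror y) ↔ lexLt y x := by
  refine exists_congr fun k => ?_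
  have hk : (!x k) < (!y k) ↔ y k < x k := by cases x k <;> cases y k <;> decide
  simp only [mirror, hk, Bool.not_inj_iff]
  simp only [eq_comm]

theorem lexLe_mirror_iff (x y : Seq) : lexLe (mirror x) (mirror y) ↔ lexLe y x := by
  rw [lexLe, lexLe, lexLt_mirror_iff, mirror_injective.eq_iff, eq_comm]

theorem mirror_mem_lexSubshift_iff (α β x : Seq) :
    mirror x ∈ lexSubshift (mirror β) (mirror α) ↔ x ∈ lexSubshift α β := by
  refine forall_congr' fun n => ?_
  rw [shift_iterate_mirror, lexLe_mirror_iff, lexLe_mirror_iff, and_comm]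

theorem Nsub_mirror (α β : Seq) : Nsub (mirror β) (mirror α) = Msub α β := by
  simp only [Nsub, Msub, shift_iterate_mirror, lexLt_mirror_iff]

theorem mirror_iotaA_mirror (α β : Seq) :
    mirror (iotaA (mirror β) (mirror α)) = iotaB α β := by
  funext i
  simp only [iotaA, iotaB, Nsub_mirror, cutZero, cutOne, mirror]
  split_ifs <;> simp

/-- A strict inequality between tails after a common prefix lifts to the whole sequences. -/
theorem lexLt_of_shift_iterate {x y : Seq} {n : ℕ} (hpre : ∀ i < n, x i = y i)
    (h : lexLt (shift^[n] x) (shift^[n] y)) : lexLt x y := by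
  obtain ⟨k, heq, hlt⟩ := h
  simp only [shift_iterate_apply] at heq hlt
  refine ⟨k + n, fun i hi => ?_, hlt⟩
  by_cases hin : i < n
  · exact hpre i hin
  · simpa [Nat.sub_add_cancel (not_lt.mp hin)] using heq (i - n) (by omega)

theorem barP_apply_zero {β : Seq} (hβ : β ∈ barP) : β 0 = false := by
  simpa [mirror] using hβ.1

theorem lexLe_shift_of_mem_barP {β : Seq} (hβ : β ∈ barP) : lexLe β (shift β) := by
  have := hβ.2 1 le_rfl
  rwa [shift_iterate_mirror, lexLe_mirror_iff] at this

theorem Nsub_spec {α β : Seq} (h : ∃ m, 1 ≤ m ∧ lexLt (shift^[m] α) β) :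
    1 ≤ Nsub α β ∧ lexLt (shift^[Nsub α β] α) β :=
  Nat.sInf_mem (s := {n | 1 ≤ n ∧ lexLt (shift^[n] α) β}) h

/-- The letter of `α` overwritten by `iotaA` is a `1`. -/
theorem apply_Nsub_sub_one {α β : Seq} (hα : α 0 = true) (hβ : β ∈ barP)
    (h : ∃ m, 1 ≤ m ∧ lexLt (shift^[m] α) β) : α (Nsub α β - 1) = true := by
  obtain ⟨hpos, hlt⟩ := Nsub_spec h
  by_contra hne
  rw [Bool.not_eq_true] at hne
  have hN : Nsub α β ≠ 1 := by
    intro h1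
    simp [h1, hα] at hne
  have hprev : lexLt (shift^[Nsub α β - 1] α) β := by
    refine lexLt_of_shift_iterate (n := 1) (fun i hi => ?_) ?_
    · obtain rfl : i = 0 := by omega
      rw [shift_iterate_apply, Nat.zero_add, hne, barP_apply_zero hβ]
    · rw [← Function.iterate_add_apply, Nat.add_sub_cancel' hpos]
      have hle := lexLe_shift_of_mem_barP hβ
      rw [lexLe_iff_toLex] at hle
      exact lt_of_lt_of_le ((lexLt_iff_toLex _ _).mp hlt) hle
  have hmin : Nsub α β ≤ Nsub α β - 1 := Nat.sInf_le ⟨by omega, hprev⟩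
  omega

theorem cutZero_apply_of_lt {α : Seq} {n i : ℕ} (hi : i < n - 1) : cutZero α n i = α i := by
  rw [cutZero, Nat.mod_eq_of_lt (by omega), if_neg (by omega)]

theorem cutZero_apply_sub_one {α : Seq} {n : ℕ} (hn : 1 ≤ n) : cutZero α n (n - 1) = false := by
  rw [cutZero, Nat.mod_eq_of_lt (by omega), if_pos rfl]

theorem cutZero_apply_add (α : Seq) (n i : ℕ) : cutZero α n (i + n) = cutZero α n i := by
  simp only [cutZero, Nat.add_mod_right]

theorem iotaA_lexLt {α β : Seq} (hα : α 0 = true) (hβ : β ∈ barP)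
    (h : ∃ m, 1 ≤ m ∧ lexLt (shift^[m] α) β) : lexLt (iotaA α β) α := by
  refine ⟨Nsub α β - 1, fun i hi => cutZero_apply_of_lt hi, ?_⟩
  rw [iotaA, cutZero_apply_sub_one (Nsub_spec h).1, apply_Nsub_sub_one hα hβ h]
  decide

theorem shift_iterate_mem_lexSubshift {α β x : Seq} (hx : x ∈ lexSubshift α β) (n : ℕ) :
    shift^[n] x ∈ lexSubshift α β := by
  intro m
  rw [← Function.iterate_add_apply]
  exact hx (m + n)

theorem lexLe_iotaA_of_mem {α β x : Seq} (hα : α 0 = true) (hβ : β ∈ barP)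
    (h : ∃ m, 1 ≤ m ∧ lexLt (shift^[m] α) β) (hx : x ∈ lexSubshift α β) :
    lexLe x (iotaA α β) := by
  obtain ⟨hpos, hlt⟩ := Nsub_spec h
  have hone := apply_Nsub_sub_one hα hβ h
  rw [← not_lexLt_iff, iotaA]
  generalize Nsub α β = N at *
  rintro ⟨k, heq, hk⟩
  induction k using Nat.strong_induction_on generalizing x with
  | _ k ih =>
    have hxα : ¬ lexLt α x := (not_lexLt_iff _ _).mpr (hx 0).2
    rcases lt_trichotomy k (N - 1) with hkN | rfl | hkN
    · refine hxα ⟨k, fun i hi => ?_, ?_⟩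
      · rw [← heq i hi, cutZero_apply_of_lt (by omega)]
      · rwa [cutZero_apply_of_lt hkN] at hk
    · refine hxα (lexLt_of_shift_iterate (n := N) (fun i hi => ?_) ?_)
      · rcases Nat.lt_or_ge i (N - 1) with hi' | hi'
        · rw [← heq i hi', cutZero_apply_of_lt hi']
        · obtain rfl : i = N - 1 := by omega
          rw [hone, eq_comm]
          exact Bool.eq_true_of_true_le (Bool.lt_iff.mp hk).2.ge
      · exact lt_of_lt_of_le ((lexLt_iff_toLex _ _).mp hlt) ((lexLe_iff_toLex _ _).mp (hx N).1)
    · refine ih (k - N) (by omega) (shift_iterate_mem_lexSubshift hx N) (fun i hi => ?_) ?_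
      · rw [shift_iterate_apply, ← heq (i + N) (by omega), cutZero_apply_add]
      · rw [shift_iterate_apply, ← cutZero_apply_add, Nat.sub_add_cancel (by omega)]
        exact hk

/-- if (α,β) ∈ P × P̄ is two sided extremal then
Σ_{(α,β)} = Σ_{(ι(α), ι(β))}. -/
theorem statement11 (α β : Seq) (hα : α ∈ ParryP) (hβ : β ∈ barP)
    (h : twoSidedExtremal α β) :
    lexSubshift α β = lexSubshift (iotaA α β) (iotaB α β) := by
  have hα' : mirror α ∈ barP := by rwa [barP, Set.mem_ofPred_eq, mirror_mirror]
  have h' : ∃ m, 1 ≤ m ∧ lexLt (shift^[m] (mirror β)) (mirror α) := by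
    simpa only [shift_iterate_mirror, lexLt_mirror_iff] using h.1
  have hB : lexLt β (iotaB α β) := by
    rw [← lexLt_mirror_iff, ← mirror_iotaA_mirror, mirror_mirror]
    exact iotaA_lexLt hβ.1 hα' h'
  ext x
  constructor
  · intro hx n
    have hxn := shift_iterate_mem_lexSubshift hx n
    refine ⟨?_, lexLe_iotaA_of_mem hα.1 hβ h.2 hxn⟩
    rw [← lexLe_mirror_iff, ← mirror_iotaA_mirror, mirror_mirror]
    exact lexLe_iotaA_of_mem hβ.1 hα' h' ((mirror_mem_lexSubshift_iff _ _ _).mpr hxn)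
  · intro hx n
    obtain ⟨hxB, hxA⟩ := hx n
    rw [lexLe_iff_toLex] at hxB hxA
    exact ⟨Or.inl (lt_of_lt_of_le ((lexLt_iff_toLex _ _).mp hB) hxB),
      Or.inl (lt_of_le_of_lt hxA ((lexLt_iff_toLex _ _).mp (iotaA_lexLt hα.1 hβ h.2)))⟩

end DoublingHole
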